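/- Let M > 1, m = 1 + 1/M, μ > 0, τ > −μ, E > 0 and q ∈ ℝ². Then the function k ↦ 1/(m|k|² + E) − χ_{(μ,∞)}(|k|²)/((1/M)|q−k|² + |k|² + τ) is integrable on ℝ², and ∫_{ℝ²} [ 1/(m|k|² + E) − χ_{(μ,∞)}(|k|²)/((1/M)|q−k|² + |k|² + τ) ] d²k = (π/m) log( (|q|²/(M+1) + τ + mμ)/E ) + (π/m) log( 1 − F(|q|², τ)/2 ), where F(s,τ) = ((s/M + τ + mμ)/(s/(M+1) + τ + mμ)) · ( 1 − √( 1 − 4sμ/(M²(s/M + τ + mμ)²) ) ). -/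

import Mathlib

open Real MeasureTheory Set

/-- The momentum lattice point `(2π/L)·z` for `z ∈ ℤ²`. -/
noncomputable def kvec (L : ℝ) (z : ℤ × ℤ) : ℝ × ℝ :=
  ((2 * Real.pi / L) * z.1, (2 * Real.pi / L) * z.2)

/-- Euclidean norm squared on `ℝ²`. -/
noncomputable def nsq (v : ℝ × ℝ) : ℝ := v.1 ^ 2 + v.2 ^ 2

/-- `χ_{(μ,∞)}(s)`. -/
noncomputable def chi (μ s : ℝ) : ℝ := if μ < s then 1 else 0

/-- The function `F(s,τ)` (with `m = 1 + 1/M`). -/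
noncomputable def Ffun (M μ s τ : ℝ) : ℝ :=
  ((s / M + τ + (1 + 1 / M) * μ) / (s / (M + 1) + τ + (1 + 1 / M) * μ)) *
    (1 - Real.sqrt (1 - 4 * s * μ / (M ^ 2 * (s / M + τ + (1 + 1 / M) * μ) ^ 2)))

open Filter Topology

theorem setIntegral_one_div_sub_cos_sin {a x y : ℝ} (ha : 0 < a) (h : x ^ 2 + y ^ 2 < a ^ 2) :
    ∫ θ in Ioo (-π) π, 1 / (a - (x * cos θ + y * sin θ)) =
      2 * π / √(a ^ 2 - (x ^ 2 + y ^ 2)) := by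
  set D := √(a ^ 2 - (x ^ 2 + y ^ 2)) with hD
  have hD0 : 0 < D := Real.sqrt_pos.2 (by linarith)
  have hDsq : D ^ 2 = a ^ 2 - (x ^ 2 + y ^ 2) := Real.sq_sqrt (by linarith)
  have haD : 0 < a + D := by positivity
  set w : ℂ := ⟨x / (a + D), y / (a + D)⟩ with hw
  have hwn : ‖w‖ ^ 2 = (a - D) / (a + D) := by
    rw [← Complex.normSq_eq_norm_sq, hw, Complex.normSq_mk]
    field_simp
    linarith
  have hw1 : w ∈ Metric.ball (0 : ℂ) 1 := by
    rw [mem_ball_zero_iff, ← sq_lt_one_iff₀ (norm_nonneg w), hwn, div_lt_one haD]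
    linarith
  have key := (InnerProductSpace.harmonicContOnCl_const (c := (1 : ℝ))
    (s := Metric.ball (0 : ℂ) 1)).circleAverage_poissonKernel_smul hw1
  rw [Real.circleAverage_eq_integral_add (-π),
    intervalIntegral.integral_comp_add_right
      (fun θ ↦ (poissonKernel 0 w • fun _ ↦ (1 : ℝ)) (circleMap 0 1 θ)),
    show 0 + -π = -π by ring, show 2 * π + -π = π by ring,
    intervalIntegral.integral_of_le (by linarith [pi_pos]), integral_Ioc_eq_integral_Ioo,
    smul_eq_mul, inv_mul_eq_iff_eq_mul₀ (by positivity), mul_one] at key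
  have hker : ∀ θ, 1 / (a - (x * cos θ + y * sin θ)) =
      (1 / D) * (poissonKernel 0 w • fun _ ↦ (1 : ℝ)) (circleMap 0 1 θ) := by
    intro θ
    have hz : circleMap 0 1 θ = ⟨cos θ, sin θ⟩ := by
      apply Complex.ext <;> simp [circleMap, Complex.exp_ofReal_mul_I_re,
        Complex.exp_ofReal_mul_I_im]
    have hzn : ‖circleMap 0 1 θ‖ = 1 := by simp
    have hden : ‖circleMap 0 1 θ - w‖ ^ 2 = 2 / (a + D) * (a - (x * cos θ + y * sin θ)) := by
      rw [← Complex.normSq_eq_norm_sq, hz, hw, Complex.normSq_apply]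
      simp only [Complex.sub_re, Complex.sub_im]
      field_simp
      linear_combination (a + D) ^ 2 * sin_sq_add_cos_sq θ + hDsq
    rw [Pi.smul_apply', poissonKernel_def]
    simp only [sub_zero, smul_eq_mul, mul_one]
    rw [hzn, hwn, hden, show (1 : ℝ) ^ 2 - (a - D) / (a + D) = 2 / (a + D) * D by
      field_simp; ring, mul_div_mul_left _ _ (by positivity)]
    field_simp
  simp_rw [hker]
  rw [integral_const_mul, key]
  ring

theorem hasDerivAt_log_sqrt_quadratic {m c p u : ℝ} (hm : m ≠ 0)
    (hQ : 0 < (m * u + c) ^ 2 - p * u)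
    (hA : 0 < √((m * u + c) ^ 2 - p * u) + m * u + (c - p / (2 * m))) :
    HasDerivAt (fun u ↦ log (√((m * u + c) ^ 2 - p * u) + m * u + (c - p / (2 * m))))
      (m / √((m * u + c) ^ 2 - p * u)) u := by
  have h1 : HasDerivAt (fun u ↦ (m * u + c) ^ 2 - p * u) (2 * (m * u + c) * m - p) u :=
    (((((hasDerivAt_id' u).const_mul m).add_const c).fun_pow 2).fun_sub
      ((hasDerivAt_id' u).const_mul p)).congr_deriv (by simp)
  refine ((((h1.sqrt hQ.ne').fun_add ((hasDerivAt_id' u).const_mul m)).add_const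
    (c - p / (2 * m))).log hA.ne').congr_deriv ?_
  have hs := Real.sqrt_pos.2 hQ
  set S := √((m * u + c) ^ 2 - p * u)
  rw [div_eq_div_iff hA.ne' hs.ne']
  field_simp
  ring

theorem tendsto_log_sqrt_quadratic {m c p E : ℝ} (hm : 0 < m) :
    Tendsto (fun u ↦ log ((m * u + E) /
      (√((m * u + c) ^ 2 - p * u) + m * u + (c - p / (2 * m))))) atTop (𝓝 (-log 2)) := by
  have hv : Tendsto (fun u : ℝ ↦ u⁻¹) atTop (𝓝 0) := tendsto_inv_atTop_zero
  have hcont : ContinuousAt (fun v : ℝ ↦ log ((m + E * v) /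
      (√((m + c * v) ^ 2 - p * v) + m + (c - p / (2 * m)) * v))) 0 := by
    have hne : √((m + c * 0) ^ 2 - p * 0) + m + (c - p / (2 * m)) * 0 ≠ 0 := by
      have := Real.sqrt_nonneg ((m + c * 0) ^ 2 - p * 0)
      rw [mul_zero (c - _), add_zero]
      positivity
    refine ContinuousAt.log (ContinuousAt.div (by fun_prop) (by fun_prop) hne) ?_
    exact div_ne_zero (by simpa using hm.ne') hne
  have h := hcont.tendsto.comp hv
  have hval : log ((m + E * 0) / (√((m + c * 0) ^ 2 - p * 0) + m + (c - p / (2 * m)) * 0)) =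
      -log 2 := by
    simp only [mul_zero, add_zero, sub_zero, Real.sqrt_sq hm.le]
    rw [← Real.log_inv]
    congr 1
    field_simp
    norm_num
  rw [hval] at h
  refine h.congr' ?_
  filter_upwards [eventually_gt_atTop 0] with u hu
  simp only [Function.comp]
  have hsq : √((m * u + c) ^ 2 - p * u) = u * √((m + c * u⁻¹) ^ 2 - p * u⁻¹) := by
    rw [show (m * u + c) ^ 2 - p * u = u ^ 2 * ((m + c * u⁻¹) ^ 2 - p * u⁻¹) by field_simp,
      Real.sqrt_mul (by positivity), Real.sqrt_sq hu.le]
  rw [hsq, ← mul_div_mul_left (m + E * u⁻¹) _ hu.ne']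
  congr 2
  · field_simp
  · field_simp

theorem measurable_nsq : Measurable nsq := by unfold nsq; fun_prop

theorem measurable_chi (μ : ℝ) : Measurable (chi μ) :=
  Measurable.ite measurableSet_Ioi measurable_const measurable_const

theorem integrable_one_div_sub_chi_div {M μ τ E : ℝ} (q : ℝ × ℝ) (hM : 0 < M) (hμ : 0 < μ)
    (hτ : -μ < τ) (hE : 0 < E) :
    Integrable (fun k : ℝ × ℝ =>
      1 / ((1 + 1 / M) * nsq k + E) -
        chi μ (nsq k) / ((1 / M) * nsq (q - k) + nsq k + τ)) := by
  have hint := integrable_one_add_norm (E := ℝ × ℝ) (μ := volume) (r := 3) (by simp; norm_num)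
  set A := |nsq q / M + τ - E| + 2 / M * (|q.1| + |q.2|) with hA
  set c₁ := min 1 E / 2 with hc₁
  set ε := min 1 ((μ + τ) / (1 + μ)) with hε
  have hc₁0 : 0 < c₁ := by positivity
  have hε0 : 0 < ε := lt_min one_pos (div_pos (by linarith) (by linarith))
  have hA0 : 0 ≤ A := by positivity
  refine (hint.const_mul ((1 + √μ) ^ 3 / E + A / (c₁ * (ε / 2)))).mono' ?_ ?_
  · apply Measurable.aestronglyMeasurable
    have := measurable_nsq
    have := measurable_chi μ
    fun_prop
  refine ae_of_all _ fun k ↦ ?_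
  set x := ‖k‖ with hx
  have hx0 : 0 ≤ x := norm_nonneg k
  have hk1 : |k.1| ≤ x := norm_fst_le k
  have hk2 : |k.2| ≤ x := norm_snd_le k
  have hxN : x ^ 2 ≤ nsq k := by
    rw [hx, Prod.norm_def, nsq]
    rcases max_choice ‖k.1‖ ‖k.2‖ with h | h <;> rw [h, Real.norm_eq_abs, sq_abs] <;>
      nlinarith [sq_nonneg k.1, sq_nonneg k.2]
  have hN0 : 0 ≤ nsq k := le_trans (sq_nonneg x) hxN
  have hM1 : 0 < 1 / M := by positivity
  rw [show (-(3 : ℝ)) = ((-3 : ℤ) : ℝ) by norm_num, Real.rpow_intCast,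
    show (1 + x) ^ (-3 : ℤ) = 1 / (1 + x) ^ 3 by rw [zpow_neg, one_div]; rfl]
  have hD₁ : 0 < (1 + 1 / M) * nsq k + E := by positivity
  by_cases hk : μ < nsq k
  · have hchi : chi μ (nsq k) = 1 := if_pos hk
    have hq0 : 0 ≤ nsq (q - k) := by unfold nsq; positivity
    have hD₁' : c₁ * (1 + x) ^ 2 ≤ (1 + 1 / M) * nsq k + E := by
      have h1 : 2 * c₁ ≤ 1 := by rw [hc₁]; linarith [min_le_left 1 E]
      have h2 : 2 * c₁ ≤ E := by rw [hc₁]; linarith [min_le_right 1 E]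
      nlinarith [sq_nonneg (1 - x), mul_nonneg hM1.le hN0]
    have hD₂' : ε / 2 * (1 + x) ^ 2 ≤ (1 / M) * nsq (q - k) + nsq k + τ := by
      have h1 : ε ≤ 1 := min_le_left _ _
      have h2 : ε * (1 + μ) ≤ μ + τ := by
        rw [← le_div_iff₀ (by linarith)]; exact min_le_right _ _
      have h3 : ε * (1 + nsq k) ≤ nsq k + τ := by nlinarith
      nlinarith [sq_nonneg (1 - x), mul_nonneg hM1.le hq0]
    have hD₂ : 0 < (1 / M) * nsq (q - k) + nsq k + τ := by
      refine lt_of_lt_of_le ?_ hD₂'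
      positivity
    rw [hchi, div_sub_div _ _ hD₁.ne' hD₂.ne', norm_div, Real.norm_eq_abs, Real.norm_eq_abs,
      abs_of_pos (mul_pos hD₁ hD₂)]
    have hnum : |1 * ((1 / M) * nsq (q - k) + nsq k + τ) - ((1 + 1 / M) * nsq k + E) * 1| ≤
        A * (1 + x) := by
      have he : 1 * ((1 / M) * nsq (q - k) + nsq k + τ) - ((1 + 1 / M) * nsq k + E) * 1 =
          (nsq q / M + τ - E) - 2 / M * (q.1 * k.1 + q.2 * k.2) := by
        simp only [nsq, Prod.fst_sub, Prod.snd_sub]; ring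
      rw [he]
      have h1 : |q.1 * k.1 + q.2 * k.2| ≤ (|q.1| + |q.2|) * x := by
        refine (abs_add_le _ _).trans ?_
        rw [abs_mul, abs_mul, add_mul]
        gcongr
      refine (abs_sub _ _).trans ?_
      rw [abs_mul, abs_of_pos (show 0 < 2 / M by positivity), hA]
      have h2 := mul_le_mul_of_nonneg_left h1 (show 0 ≤ 2 / M by positivity)
      have h3 : 0 ≤ 2 / M * (|q.1| + |q.2|) := by positivity
      nlinarith [mul_nonneg (abs_nonneg (nsq q / M + τ - E)) hx0]
    calc _ ≤ A * (1 + x) / ((c₁ * (1 + x) ^ 2) * (ε / 2 * (1 + x) ^ 2)) := by gcongr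
      _ = A / (c₁ * (ε / 2)) * (1 / (1 + x) ^ 3) := by field_simp
      _ ≤ _ := by
        gcongr
        have : 0 ≤ (1 + √μ) ^ 3 / E := by positivity
        linarith
  · have hchi : chi μ (nsq k) = 0 := if_neg hk
    have hxμ : x ≤ √μ := Real.le_sqrt_of_sq_le (hxN.trans (not_lt.1 hk))
    rw [hchi, zero_div, sub_zero, Real.norm_eq_abs, abs_of_pos (by positivity)]
    calc _ ≤ 1 / E := by
          gcongr
          have : 0 ≤ (1 + 1 / M) * nsq k := by positivity
          linarith
      _ = (1 + x) ^ 3 / E * (1 / (1 + x) ^ 3) := by field_simp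
      _ ≤ (1 + √μ) ^ 3 / E * (1 / (1 + x) ^ 3) := by gcongr
      _ ≤ _ := by
        gcongr
        have : 0 ≤ A / (c₁ * (ε / 2)) := by positivity
        linarith

theorem integrableOn_polarCoord_symm {f : ℝ × ℝ → ℝ} (hf : Integrable f) :
    IntegrableOn (fun p : ℝ × ℝ ↦ p.1 * f (polarCoord.symm p)) (Ioi 0 ×ˢ Ioo (-π) π) := by
  have h := (integrableOn_image_iff_integrableOn_abs_det_fderiv_smul volume
    polarCoord.open_target.measurableSet
    (fun p _ ↦ (hasFDerivAt_polarCoord_symm p).hasFDerivWithinAt)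
    polarCoord.symm.injOn f).1 hf.integrableOn
  refine h.congr_fun (fun p hp ↦ ?_) polarCoord.open_target.measurableSet
  simp only [det_fderivPolarCoordSymm, smul_eq_mul]
  rw [abs_of_pos hp.1]

theorem integrableOn_one_div_sub_cos_sin {a x y : ℝ} (h : x ^ 2 + y ^ 2 < a ^ 2) :
    IntegrableOn (fun θ ↦ 1 / (a - (x * cos θ + y * sin θ))) (Ioo (-π) π) := by
  have hne : ∀ θ, a - (x * cos θ + y * sin θ) ≠ 0 := by
    intro θ h0
    rw [sub_eq_zero.1 h0] at h
    have h1 : x ^ 2 + y ^ 2 = (x ^ 2 + y ^ 2) * (sin θ ^ 2 + cos θ ^ 2) := by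
      rw [sin_sq_add_cos_sq, mul_one]
    nlinarith [sq_nonneg (x * sin θ - y * cos θ)]
  have hc : Continuous fun θ ↦ 1 / (a - (x * cos θ + y * sin θ)) :=
    continuous_const.div (by fun_prop) hne
  exact (hc.integrableOn_Icc (a := -π) (b := π)).mono_set Ioo_subset_Icc_self

theorem integral_Ioi_radial {m c p μ E : ℝ} (hm : 0 < m) (hμ : 0 < μ) (hE : 0 < E)
    (hQ : ∀ u, μ ≤ u → 0 < (m * u + c) ^ 2 - p * u)
    (hA : ∀ u, μ ≤ u → 0 < √((m * u + c) ^ 2 - p * u) + m * u + (c - p / (2 * m)))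
    (hint : IntegrableOn (fun r ↦ r * (2 * π * (1 / (m * r ^ 2 + E)) -
      chi μ (r ^ 2) * (2 * π / √((m * r ^ 2 + c) ^ 2 - p * r ^ 2)))) (Ioi 0)) :
    ∫ r in Ioi 0, r * (2 * π * (1 / (m * r ^ 2 + E)) -
      chi μ (r ^ 2) * (2 * π / √((m * r ^ 2 + c) ^ 2 - p * r ^ 2))) =
    π / m * (log (√((m * μ + c) ^ 2 - p * μ) + m * μ + (c - p / (2 * m))) -
      log 2 - log E) := by
  have hs0 : 0 ≤ √μ := Real.sqrt_nonneg μ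
  have hsμ : √μ ^ 2 = μ := Real.sq_sqrt hμ.le
  have hlog : ∀ r : ℝ, HasDerivAt (fun r ↦ log (m * r ^ 2 + E))
      (2 * m * r / (m * r ^ 2 + E)) r := fun r ↦
    (((((hasDerivAt_id' r).fun_pow 2).const_mul m).add_const E).log
      (by positivity)).congr_deriv (by simp; ring)
  rw [← Ioc_union_Ioi_eq_Ioi hs0] at hint ⊢
  rw [setIntegral_union Ioc_disjoint_Ioi_same measurableSet_Ioi
    hint.left_of_union hint.right_of_union]
  have hinner : ∫ r in Ioc 0 √μ, r * (2 * π * (1 / (m * r ^ 2 + E)) -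
      chi μ (r ^ 2) * (2 * π / √((m * r ^ 2 + c) ^ 2 - p * r ^ 2))) =
      π / m * (log (m * μ + E) - log E) := by
    have hcongr : ∀ r ∈ Ioc 0 √μ, r * (2 * π * (1 / (m * r ^ 2 + E)) -
        chi μ (r ^ 2) * (2 * π / √((m * r ^ 2 + c) ^ 2 - p * r ^ 2))) =
        π / m * (2 * m * r / (m * r ^ 2 + E)) := by
      intro r hr
      have : ¬ μ < r ^ 2 := by
        rw [not_lt, ← hsμ]; exact pow_le_pow_left₀ hr.1.le hr.2 2
      rw [chi, if_neg this]
      field_simp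
      ring
    rw [setIntegral_congr_fun measurableSet_Ioc hcongr, integral_const_mul,
      ← intervalIntegral.integral_of_le hs0,
      intervalIntegral.integral_eq_sub_of_hasDerivAt (fun r _ ↦ hlog r), hsμ]
    · simp
    · apply Continuous.intervalIntegrable
      exact Continuous.div (by fun_prop) (by fun_prop) fun r ↦ by positivity
  have houter : ∫ r in Ioi √μ, r * (2 * π * (1 / (m * r ^ 2 + E)) -
      chi μ (r ^ 2) * (2 * π / √((m * r ^ 2 + c) ^ 2 - p * r ^ 2))) =
      π / m * (-log 2) - π / m * (log (m * μ + E) -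
        log (√((m * μ + c) ^ 2 - p * μ) + m * μ + (c - p / (2 * m)))) := by
    have hcongr : EqOn (fun r ↦ r * (2 * π * (1 / (m * r ^ 2 + E)) -
        chi μ (r ^ 2) * (2 * π / √((m * r ^ 2 + c) ^ 2 - p * r ^ 2))))
        (fun r ↦ π / m * (2 * m * r / (m * r ^ 2 + E) -
          m / √((m * r ^ 2 + c) ^ 2 - p * r ^ 2) * (2 * r))) (Ioi √μ) := by
      intro r hr
      have hr' : μ < r ^ 2 := by
        rw [← hsμ]; exact pow_lt_pow_left₀ hr hs0 two_ne_zero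
      have := Real.sqrt_pos.2 (hQ _ hr'.le)
      simp only [chi, if_pos hr']
      field_simp
    have hint' := hint.right_of_union.congr_fun hcongr measurableSet_Ioi
    rw [setIntegral_congr_fun measurableSet_Ioi hcongr]
    have hderiv : ∀ r ∈ Ici √μ, HasDerivAt (fun r ↦ π / m * (log (m * r ^ 2 + E) -
        log (√((m * r ^ 2 + c) ^ 2 - p * r ^ 2) + m * r ^ 2 + (c - p / (2 * m)))))
        (π / m * (2 * m * r / (m * r ^ 2 + E) -
          m / √((m * r ^ 2 + c) ^ 2 - p * r ^ 2) * (2 * r))) r := by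
      intro r hr
      have hr' : μ ≤ r ^ 2 := by
        rw [← hsμ]; exact pow_le_pow_left₀ hs0 hr 2
      have h1 : HasDerivAt (fun r : ℝ ↦ r ^ 2) (2 * r) r := by simpa using hasDerivAt_pow 2 r
      have h2 := HasDerivAt.comp (h := fun r : ℝ ↦ r ^ 2) r
        (hasDerivAt_log_sqrt_quadratic hm.ne' (hQ _ hr') (hA _ hr')) h1
      exact ((hlog r).fun_sub h2).const_mul (π / m)
    have htend : Tendsto (fun r ↦ π / m * (log (m * r ^ 2 + E) -
        log (√((m * r ^ 2 + c) ^ 2 - p * r ^ 2) + m * r ^ 2 + (c - p / (2 * m)))))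
        atTop (𝓝 (π / m * (-log 2))) := by
      have h := ((tendsto_log_sqrt_quadratic (c := c) (p := p) (E := E) hm).comp
        (tendsto_pow_atTop (α := ℝ) two_ne_zero)).const_mul (π / m)
      refine h.congr' ?_
      filter_upwards [eventually_ge_atTop √μ] with r hr
      have hr' : μ ≤ r ^ 2 := by
        rw [← hsμ]; exact pow_le_pow_left₀ hs0 hr 2
      simp only [Function.comp]
      rw [Real.log_div (by positivity) (hA _ hr').ne']
    rw [integral_Ioi_of_hasDerivAt_of_tendsto' hderiv hint' htend, hsμ]
  rw [hinner, houter]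
  ring

theorem log_add_log_one_sub_Ffun {M μ τ E s : ℝ} (hM : 1 < M) (hμ : 0 < μ) (hτ : -μ < τ)
    (hE : 0 < E) (hs : 0 ≤ s) :
    log ((s / (M + 1) + τ + (1 + 1 / M) * μ) / E) + log (1 - Ffun M μ s τ / 2) =
      log (√(((1 + 1 / M) * μ + (s / M + τ)) ^ 2 - 4 * s / M ^ 2 * μ) + (1 + 1 / M) * μ +
        ((s / M + τ) - 4 * s / M ^ 2 / (2 * (1 + 1 / M)))) - log 2 - log E := by
  have hM0 : 0 < M := by linarith
  have hmμ : 0 < τ + (1 + 1 / M) * μ := by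
    have : 0 < 1 / M * μ := by positivity
    linarith
  set X := s / (M + 1) + τ + (1 + 1 / M) * μ with hX
  set Y := s / M + τ + (1 + 1 / M) * μ with hY
  have hX0 : 0 < X := by
    have : 0 ≤ s / (M + 1) := by positivity
    linarith
  have hY0 : 0 < Y := by
    have : 0 ≤ s / M := by positivity
    linarith
  have hXY : 0 < 2 * X - Y := by
    have h : s / M ≤ 2 * (s / (M + 1)) := by
      rw [mul_div_assoc', div_le_div_iff₀ hM0 (by linarith)]
      nlinarith
    linarith
  have hsqrt : √(((1 + 1 / M) * μ + (s / M + τ)) ^ 2 - 4 * s / M ^ 2 * μ) =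
      Y * √(1 - 4 * s * μ / (M ^ 2 * Y ^ 2)) := by
    rw [show ((1 + 1 / M) * μ + (s / M + τ)) = Y by rw [hY]; ring,
      show Y ^ 2 - 4 * s / M ^ 2 * μ = Y ^ 2 * (1 - 4 * s * μ / (M ^ 2 * Y ^ 2)) by field_simp,
      Real.sqrt_mul (sq_nonneg Y), Real.sqrt_sq hY0.le]
  set R := √(1 - 4 * s * μ / (M ^ 2 * Y ^ 2)) with hR
  have hR0 : 0 ≤ R := Real.sqrt_nonneg _
  have hF : 1 - Ffun M μ s τ / 2 = (2 * X - Y + Y * R) / (2 * X) := by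
    rw [Ffun, ← hX, ← hY, ← hR]
    field_simp
    ring
  have hrest : (1 + 1 / M) * μ + ((s / M + τ) - 4 * s / M ^ 2 / (2 * (1 + 1 / M))) =
      2 * X - Y := by
    rw [hX, hY]
    field_simp
    ring
  have hpos : 0 < 2 * X - Y + Y * R := by positivity
  rw [hsqrt, add_assoc, hrest, add_comm (Y * R), hF, Real.log_div hX0.ne' hE.ne',
    Real.log_div hpos.ne' (by positivity), Real.log_mul two_ne_zero hX0.ne']
  ring

theorem stmt_8 (M μ τ E : ℝ) (q : ℝ × ℝ) (hM : 1 < M) (hμ : 0 < μ) (hτ : -μ < τ)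
    (hE : 0 < E) :
    Integrable (fun k : ℝ × ℝ =>
      1 / ((1 + 1 / M) * nsq k + E) - chi μ (nsq k) / ((1 / M) * nsq (q - k) + nsq k + τ)) ∧
    (∫ k : ℝ × ℝ,
        (1 / ((1 + 1 / M) * nsq k + E)
          - chi μ (nsq k) / ((1 / M) * nsq (q - k) + nsq k + τ)))
      = (π / (1 + 1 / M)) * Real.log ((nsq q / (M + 1) + τ + (1 + 1 / M) * μ) / E)
        + (π / (1 + 1 / M)) * Real.log (1 - Ffun M μ (nsq q) τ / 2) := by
  have hM0 : 0 < M := by linarith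
  have hint := integrable_one_div_sub_chi_div q hM0 hμ hτ hE
  refine ⟨hint, ?_⟩
  have hs : 0 ≤ nsq q := by unfold nsq; positivity
  rw [← mul_add, log_add_log_one_sub_Ffun hM hμ hτ hE hs]
  have hm : 0 < 1 + 1 / M := by positivity
  have hQ : ∀ u, μ ≤ u →
      0 < ((1 + 1 / M) * u + (nsq q / M + τ)) ^ 2 - 4 * nsq q / M ^ 2 * u := by
    intro u hu
    have h1 : 0 < u + τ := by linarith
    have h2 : 0 ≤ (u + nsq q) / M := div_nonneg (by linarith) hM0.le
    have h3 : ((1 + 1 / M) * u + (nsq q / M + τ)) ^ 2 - 4 * nsq q / M ^ 2 * u =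
        (u + τ) ^ 2 + 2 * (u + τ) * ((u + nsq q) / M) + ((u - nsq q) / M) ^ 2 := by
      field_simp
      ring
    rw [h3]
    positivity
  have hA : ∀ u, μ ≤ u →
      0 < √(((1 + 1 / M) * u + (nsq q / M + τ)) ^ 2 - 4 * nsq q / M ^ 2 * u) +
        (1 + 1 / M) * u + ((nsq q / M + τ) - 4 * nsq q / M ^ 2 / (2 * (1 + 1 / M))) := by
    intro u hu
    have h1 : 0 < u / M := div_pos (by linarith) hM0
    have h2 : (1 + 1 / M) * u + ((nsq q / M + τ) - 4 * nsq q / M ^ 2 / (2 * (1 + 1 / M))) =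
        u / M + (u + τ) + nsq q * (M - 1) / (M * (M + 1)) := by
      field_simp
      ring
    have h3 : 0 ≤ nsq q * (M - 1) / (M * (M + 1)) :=
      div_nonneg (mul_nonneg hs (by linarith)) (by positivity)
    rw [add_assoc, h2]
    have := Real.sqrt_nonneg
      (((1 + 1 / M) * u + (nsq q / M + τ)) ^ 2 - 4 * nsq q / M ^ 2 * u)
    linarith
  have hpolar := integrableOn_polarCoord_symm hint
  have hangular : ∀ r ∈ Ioi (0 : ℝ), ∫ θ in Ioo (-π) π,
      r * (1 / ((1 + 1 / M) * nsq (polarCoord.symm (r, θ)) + E) -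
        chi μ (nsq (polarCoord.symm (r, θ))) /
          ((1 / M) * nsq (q - polarCoord.symm (r, θ)) + nsq (polarCoord.symm (r, θ)) + τ)) =
      r * (2 * π * (1 / ((1 + 1 / M) * r ^ 2 + E)) - chi μ (r ^ 2) * (2 * π /
        √(((1 + 1 / M) * r ^ 2 + (nsq q / M + τ)) ^ 2 - 4 * nsq q / M ^ 2 * r ^ 2))) := by
    intro r hr
    have hnsq : ∀ θ, nsq (polarCoord.symm (r, θ)) = r ^ 2 := by
      intro θ
      simp only [nsq, polarCoord_symm_apply]
      linear_combination r ^ 2 * sin_sq_add_cos_sq θ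
    have hden : ∀ θ, (1 / M) * nsq (q - polarCoord.symm (r, θ)) + r ^ 2 + τ =
        ((1 + 1 / M) * r ^ 2 + (nsq q / M + τ)) -
          (2 / M * r * q.1 * cos θ + 2 / M * r * q.2 * sin θ) := by
      intro θ
      simp only [nsq, polarCoord_symm_apply, Prod.fst_sub, Prod.snd_sub]
      linear_combination 1 / M * r ^ 2 * sin_sq_add_cos_sq θ
    have hconst : ∫ _ in Ioo (-π) π, 1 / ((1 + 1 / M) * r ^ 2 + E) =
        2 * π * (1 / ((1 + 1 / M) * r ^ 2 + E)) := by
      rw [setIntegral_const, Measure.real, Real.volume_Ioo,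
        ENNReal.toReal_ofReal (by linarith [pi_pos]), smul_eq_mul]
      ring
    simp_rw [hnsq, hden]
    rw [integral_const_mul]
    congr 1
    by_cases h : μ < r ^ 2
    · have hp : (2 / M * r * q.1) ^ 2 + (2 / M * r * q.2) ^ 2 =
          4 * nsq q / M ^ 2 * r ^ 2 := by
        simp only [nsq]; ring
      have ha : 0 < (1 + 1 / M) * r ^ 2 + (nsq q / M + τ) := by
        have h1 : 0 ≤ nsq q / M := by positivity
        have h2 : 0 ≤ 1 / M * r ^ 2 := by positivity
        linarith
      have hlt : (2 / M * r * q.1) ^ 2 + (2 / M * r * q.2) ^ 2 <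
          ((1 + 1 / M) * r ^ 2 + (nsq q / M + τ)) ^ 2 := by
        rw [hp]; linarith [hQ _ h.le]
      simp only [chi, if_pos h]
      rw [integral_sub (by simp) (integrableOn_one_div_sub_cos_sin hlt), hconst,
        setIntegral_one_div_sub_cos_sin ha hlt, hp, one_mul]
    · simp only [chi, if_neg h, zero_div, sub_zero, zero_mul]
      exact hconst
  have hrad : IntegrableOn (fun r ↦ r * (2 * π * (1 / ((1 + 1 / M) * r ^ 2 + E)) -
      chi μ (r ^ 2) * (2 * π /
        √(((1 + 1 / M) * r ^ 2 + (nsq q / M + τ)) ^ 2 - 4 * nsq q / M ^ 2 * r ^ 2))))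
      (Ioi 0) := by
    have h := hpolar
    rw [IntegrableOn, Measure.volume_eq_prod, ← Measure.prod_restrict] at h
    exact IntegrableOn.congr_fun h.integral_prod_left hangular measurableSet_Ioi
  rw [← integral_comp_polarCoord_symm, polarCoord_target]
  simp only [smul_eq_mul]
  rw [Measure.volume_eq_prod, setIntegral_prod _ (by rwa [← Measure.volume_eq_prod]),
    setIntegral_congr_fun measurableSet_Ioi hangular,
    integral_Ioi_radial hm hμ hE hQ hA hrad]
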